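/- (Lemma: variance bound for the weighted kernel.) Assume W₂ := E_{X∼MP}[1/M(X)²] < ∞. For Z₁, Z₂ i.i.d. from MP × Q, Var(h'(Z₁,Z₂)) ≤ 5 ( K² (W₂ + 1)² + MMD²(P,Q)² ). -/

import Mathlib

open MeasureTheory ProbabilityTheory

/-- The importance-weighted kernel
`h'(z,z') = k(x,x')/(M(x)M(x')) + k(y,y') − k(x,y')/M(x) − k(x',y)/M(x')`. -/
noncomputable def hIW {𝒳 : Type*} (k : 𝒳 → 𝒳 → ℝ) (M : 𝒳 → ℝ) (z z' : 𝒳 × 𝒳) : ℝ :=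
  k z.1 z'.1 / (M z.1 * M z'.1) + k z.2 z'.2 - k z.1 z'.2 / M z.1 - k z'.1 z.2 / M z'.1

/-- Squared maximum mean discrepancy between `P` and `Q` for the kernel `k`. -/
noncomputable def mmdSq {𝒳 : Type*} [MeasurableSpace 𝒳] (k : 𝒳 → 𝒳 → ℝ)
    (P Q : Measure 𝒳) : ℝ :=
  (∫ p, k p.1 p.2 ∂(P.prod P)) + (∫ p, k p.1 p.2 ∂(Q.prod Q))
    - 2 * ∫ p, k p.1 p.2 ∂(P.prod Q)

/-- The weighted kernel is dominated by a product of functions of its two arguments. -/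
lemma hIW_sq_le {𝒳 : Type*} {k : 𝒳 → 𝒳 → ℝ} {K : ℝ} {M : 𝒳 → ℝ}
    (hk_nonneg : ∀ x y, 0 ≤ k x y) (hk_bdd : ∀ x y, k x y ≤ K) (hM_pos : ∀ x, 0 < M x)
    (z z' : 𝒳 × 𝒳) :
    hIW k M z z' ^ 2 ≤ 2 * K ^ 2 * ((1 + 1 / M z.1 ^ 2) * (1 + 1 / M z'.1 ^ 2)) := by
  have ha : 0 < (M z.1)⁻¹ := inv_pos.2 (hM_pos _)
  have hb : 0 < (M z'.1)⁻¹ := inv_pos.2 (hM_pos _)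
  have heq : hIW k M z z' = k z.1 z'.1 * ((M z.1)⁻¹ * (M z'.1)⁻¹) + k z.2 z'.2
      - (k z.1 z'.2 * (M z.1)⁻¹ + k z'.1 z.2 * (M z'.1)⁻¹) := by
    simp only [hIW, div_eq_mul_inv, mul_inv]
    ring
  rw [heq, one_div, one_div, ← inv_pow, ← inv_pow]
  set a := (M z.1)⁻¹
  set b := (M z'.1)⁻¹
  set u := k z.1 z'.1 * (a * b) + k z.2 z'.2 with hu
  set v := k z.1 z'.2 * a + k z'.1 z.2 * b with hv
  have hu_nonneg : 0 ≤ u :=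
    add_nonneg (mul_nonneg (hk_nonneg _ _) (mul_pos ha hb).le) (hk_nonneg _ _)
  have hv_nonneg : 0 ≤ v :=
    add_nonneg (mul_nonneg (hk_nonneg _ _) ha.le) (mul_nonneg (hk_nonneg _ _) hb.le)
  have hu_le : u ≤ K * (a * b) + K :=
    add_le_add (mul_le_mul_of_nonneg_right (hk_bdd _ _) (mul_pos ha hb).le) (hk_bdd _ _)
  have hv_le : v ≤ K * a + K * b :=
    add_le_add (mul_le_mul_of_nonneg_right (hk_bdd _ _) ha.le)
      (mul_le_mul_of_nonneg_right (hk_bdd _ _) hb.le)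
  have hu_sq := pow_le_pow_left₀ hu_nonneg hu_le 2
  have hv_sq := pow_le_pow_left₀ hv_nonneg hv_le 2
  nlinarith [mul_nonneg hu_nonneg hv_nonneg, sq_nonneg (K * (a * b) - K),
    sq_nonneg (K * a - K * b)]

lemma measurable_hIW {𝒳 : Type*} [MeasurableSpace 𝒳] {k : 𝒳 → 𝒳 → ℝ} {M : 𝒳 → ℝ}
    (hk_meas : Measurable (fun p : 𝒳 × 𝒳 => k p.1 p.2)) (hM_meas : Measurable M) :
    Measurable (fun z : (𝒳 × 𝒳) × (𝒳 × 𝒳) => hIW k M z.1 z.2) := by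
  have hk {f g : (𝒳 × 𝒳) × (𝒳 × 𝒳) → 𝒳} (hf : Measurable f) (hg : Measurable g) :
      Measurable fun z => k (f z) (g z) := hk_meas.comp (hf.prodMk hg)
  unfold hIW
  exact ((((hk (by fun_prop) (by fun_prop)).div (by fun_prop)).add
    (hk (by fun_prop) (by fun_prop))).sub
    ((hk (by fun_prop) (by fun_prop)).div (by fun_prop))).sub
    ((hk (by fun_prop) (by fun_prop)).div (by fun_prop))

/-- **variance bound for the weighted kernel.**
If `W₂ := E_{X∼MP}[1/M(X)²] < ∞`, then for `Z₁, Z₂` i.i.d. from `MP × Q`,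
`Var(h'(Z₁,Z₂)) ≤ 5 (K² (W₂ + 1)² + MMD²(P,Q)²)`. -/
theorem weighted_kernel_variance_bound
    {𝒳 : Type*} [MeasurableSpace 𝒳]
    (k : 𝒳 → 𝒳 → ℝ) (K : ℝ)
    (hk_meas : Measurable (fun p : 𝒳 × 𝒳 => k p.1 p.2))
    (hk_symm : ∀ x y, k x y = k y x)
    (hk_nonneg : ∀ x y, 0 ≤ k x y) (hk_bdd : ∀ x y, k x y ≤ K)
    (P Q MP : Measure 𝒳)
    [IsProbabilityMeasure P] [IsProbabilityMeasure Q] [IsProbabilityMeasure MP]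
    (M : 𝒳 → ℝ) (hM_meas : Measurable M) (hM_pos : ∀ x, 0 < M x)
    -- `P` has density `1/M` with respect to `MP`
    (hdens : P = MP.withDensity fun x => ENNReal.ofReal (1 / M x))
    -- `W₂ := E_{X∼MP}[1/M(X)²] < ∞`
    (hW2_int : Integrable (fun x => 1 / M x ^ 2) MP)
    (W2 : ℝ) (hW2 : W2 = ∫ x, 1 / M x ^ 2 ∂MP) :
    variance (fun z : (𝒳 × 𝒳) × (𝒳 × 𝒳) => hIW k M z.1 z.2)
        ((MP.prod Q).prod (MP.prod Q))
      ≤ 5 * (K ^ 2 * (W2 + 1) ^ 2 + mmdSq k P Q ^ 2) := by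
  have hf_int : Integrable (fun x => 1 + 1 / M x ^ 2) MP := (integrable_const 1).add hW2_int
  have hf_fst : Integrable (fun z : 𝒳 × 𝒳 => 1 + 1 / M z.1 ^ 2) (MP.prod Q) :=
    hf_int.comp_fst Q
  have hf_integral : ∫ z : 𝒳 × 𝒳, (1 + 1 / M z.1 ^ 2) ∂(MP.prod Q) = W2 + 1 := by
    rw [integral_fun_fst (fun x => 1 + 1 / M x ^ 2), integral_add (integrable_const 1) hW2_int,
      ← hW2]
    simp [add_comm]
  calc _ ≤ ∫ z, hIW k M z.1 z.2 ^ 2 ∂((MP.prod Q).prod (MP.prod Q)) :=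
        variance_le_expectation_sq (measurable_hIW hk_meas hM_meas).aestronglyMeasurable
    _ ≤ ∫ z, 2 * K ^ 2 * ((1 + 1 / M z.1.1 ^ 2) * (1 + 1 / M z.2.1 ^ 2))
          ∂((MP.prod Q).prod (MP.prod Q)) :=
        integral_mono_of_nonneg (ae_of_all _ fun _ => sq_nonneg _)
          ((hf_fst.mul_prod hf_fst).const_mul _)
          (ae_of_all _ fun z => hIW_sq_le hk_nonneg hk_bdd hM_pos z.1 z.2)
    _ = 2 * K ^ 2 * ((W2 + 1) * (W2 + 1)) := by
        rw [integral_const_mul,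
          integral_prod_mul (fun z : 𝒳 × 𝒳 => 1 + 1 / M z.1 ^ 2)
            (fun z : 𝒳 × 𝒳 => 1 + 1 / M z.1 ^ 2), hf_integral]
    _ ≤ 5 * (K ^ 2 * (W2 + 1) ^ 2 + mmdSq k P Q ^ 2) := by
        nlinarith [sq_nonneg (K * (W2 + 1)), sq_nonneg (mmdSq k P Q)]
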